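/- Consider a strided-well-defined processing chain with receptive field size B, layers L and stride products k_j*, and assume dim(EvalStride_L(ρ)) = 1 for all ρ ∈ M₀^B. For ξ ∈ M₀^D with D ≥ B, let r(ξ) := 0 if k_L* divides D − B + 1, and r(ξ) := k_L* − ((D − B + 1) mod k_L*) otherwise. Define T : ⋃_{q≥B} M₀^q → ⋃_{q≥1} M_L^q by T(ξ) := Trimming_{r(ξ)}(Defrag_{k_L*}(EvalSlide_L(Stuffing_{r(ξ)}(ξ)))). Then T is well-defined, T is a subsignal compatible transformation with dimensionality reduction constant B, T(ρ) = EvalStride_L(ρ) for all ρ ∈ M₀^B, and T = Slide_{EvalStride_L}. -/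

import Mathlib

namespace Scan

universe u v

/-- Extraction of the subsignal of length `d` starting at (0-based) index `i`. -/
def subsig {M : Type*} {D : ℕ} (d i : ℕ) (ξ : Fin D → M) (h : i + d ≤ D) : Fin d → M :=
  fun ν => ξ ⟨i + ν.val, by have := ν.isLt; omega⟩

/-- Application of a function in a sliding fashion. -/
def slide {M N : Type*} {c : ℕ} (f : (Fin c → M) → N) {D : ℕ} (ξ : Fin D → M) :
    Fin (D + 1 - c) → N :=
  fun i => f (subsig c i.val ξ (by have := i.isLt; omega))

/-- Application of a function in a strided fashion (to non-overlapping blocks). -/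
def strideApp {M N : Type*} {k : ℕ} (g : (Fin k → M) → N) {D : ℕ} (ξ : Fin D → M) :
    Fin (D / k) → N :=
  fun i => g (subsig k (k * i.val) ξ (by
    have h1 : k * (i.val + 1) ≤ k * (D / k) := Nat.mul_le_mul_left k i.isLt
    have h2 : (D / k) * k ≤ D := Nat.div_mul_le_self D k
    have h3 : k * (D / k) = (D / k) * k := Nat.mul_comm _ _
    have h4 : k * (i.val + 1) = k * i.val + k := Nat.mul_succ k i.val
    omega))

/-- `T` is a subsignal compatible transformation with dimensionality reduction
constant `c` (the dimensionality reduction property is encoded in the type of `T`;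
this predicate is the exchange property, stated sample-wise). -/
def IsSCT {M N : Type*} (c : ℕ) (T : ∀ D : ℕ, (Fin D → M) → Fin (D + 1 - c) → N) : Prop :=
  ∀ (d D : ℕ), c ≤ d → ∀ (ξ : Fin D → M) (i : ℕ) (h : i + d ≤ D),
    ∀ ν : Fin (d + 1 - c),
      T d (subsig d i ξ h) ν = T D ξ ⟨i + ν.val, by have := ν.isLt; omega⟩

/-- Vectorization operator. -/
def vec {M : Type*} {a b : ℕ} (ξ : Fin a → Fin b → M) : Fin (a * b) → M :=
  fun j => ξ
    ⟨j.val % a, by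
      rcases Nat.eq_zero_or_pos a with h | h
      · exact absurd j.isLt (by simp [h])
      · exact Nat.mod_lt _ h⟩
    ⟨j.val / a, Nat.div_lt_of_lt_mul j.isLt⟩

/-- Inverse vectorization operator. -/
def vecInv {M : Type*} (a b : ℕ) (ξ : Fin (a * b) → M) : Fin a → Fin b → M :=
  fun i j => ξ ⟨j.val * a + i.val, by
    have h1 : j.val * a + i.val < j.val * a + a := Nat.add_lt_add_left i.isLt _
    have h2 : j.val * a + a ≤ b * a := by
      calc j.val * a + a = (j.val + 1) * a := by ring
        _ ≤ b * a := Nat.mul_le_mul_right a j.isLt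
    calc j.val * a + i.val < j.val * a + a := h1
      _ ≤ b * a := h2
      _ = a * b := Nat.mul_comm b a⟩

/-- Matrix transpose. -/
def mtrans {M : Type*} {a b : ℕ} (ξ : Fin a → Fin b → M) : Fin b → Fin a → M :=
  fun j i => ξ i j

/-- The fragmentation operator. -/
def frag {M : Type*} (k : ℕ) {q s : ℕ} (ξ : Fin (k * q) → Fin s → M) :
    Fin q → Fin (k * s) → M :=
  mtrans (vecInv (k * s) q (fun j => vec (mtrans ξ) (Fin.cast (by ring) j)))

/-- The defragmentation operator. -/
def defrag {M : Type*} (k : ℕ) {q s : ℕ} (ξ : Fin q → Fin (k * s) → M) :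
    Fin (k * q) → Fin s → M :=
  mtrans (vecInv s (k * q) (fun j => vec (mtrans ξ) (Fin.cast (by ring) j)))

/-- Fragmentation of a matrix with an arbitrary number `r` of rows (the operator
agrees with `frag` whenever `k ∣ r`, which is guaranteed by the well-definedness
requirements of a processing chain). -/
def fragD {M : Type*} (k : ℕ) {r s : ℕ} (ξ : Fin r → Fin s → M) :
    Fin (r / k) → Fin (k * s) → M :=
  frag k (fun (i : Fin (k * (r / k))) j =>
    ξ (Fin.castLE (by
      calc k * (r / k) = (r / k) * k := Nat.mul_comm _ _
        _ ≤ r := Nat.div_mul_le_self r k) i) j)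

/-- The stride products `k_j* = ∏_{ν=1}^j k_ν` of a processing chain. -/
def kstar (k : ℕ → ℕ) (j : ℕ) : ℕ := ∏ ν ∈ Finset.range j, k ν

section Chain

variable (M : ℕ → Type u) (Nt : ℕ → Type v) (c k : ℕ → ℕ)
  (T : ∀ j : ℕ, ∀ Dq : ℕ, (Fin Dq → M j) → Fin (Dq + 1 - c j) → Nt j)
  (g : ∀ j : ℕ, (Fin (k j) → Nt j) → M (j + 1))

/-- Application of a processing chain in a strided fashion (`EvalStride`);
layer `j+1` of the paper corresponds to the data `T j`, `g j`, `c j`, `k j`. -/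
def evalStride (B : ℕ) : (j : ℕ) → (ρ : Fin B → M 0) → Σ q : ℕ, Fin q → M j
  | 0, ρ => ⟨B, ρ⟩
  | j + 1, ρ =>
    let p := evalStride B j ρ
    ⟨(p.1 + 1 - c j) / k j, strideApp (g j) (T j p.1 p.2)⟩

/-- Application of a processing chain in a sliding fashion (`EvalSlide`), producing
a fragmented signal, encoded as `⟨rows, cols, matrix⟩`; the subsignal compatible
transformation `T j` and the sliding application of `g j` act on each fragment
(column) independently, followed by fragmentation. -/
def evalSlide (D : ℕ) : (j : ℕ) → (ξ : Fin D → M 0) → Σ r : ℕ, Σ s : ℕ, Fin r → Fin s → M j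
  | 0, ξ => ⟨D, 1, fun i _ => ξ i⟩
  | j + 1, ξ =>
    let p := evalSlide D j ξ
    let A : Fin (p.1 + 1 - c j) → Fin p.2.1 → Nt j :=
      fun i col => T j p.1 (fun i' => p.2.2 i' col) i
    let Bm : Fin ((p.1 + 1 - c j) + 1 - k j) → Fin p.2.1 → M (j + 1) :=
      fun i col => slide (g j) (fun i' => A i' col) i
    ⟨((p.1 + 1 - c j) + 1 - k j) / k j, k j * p.2.1, fragD (k j) Bm⟩

/-- A processing chain is strided-well-defined if in every layer the stride `k j`
divides the dimensionality of `T j (EvalStride_j ρ)` and the resulting signal is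
non-empty. -/
def StridedWellDefined (B L : ℕ) : Prop :=
  ∀ j, j < L → ∀ ρ : Fin B → M 0,
    (k j ∣ ((evalStride M Nt c k T g B j ρ).1 + 1 - c j)) ∧
    0 < (evalStride M Nt c k T g B (j + 1) ρ).1

/-- The stuffing operator: append `r` copies of the dummy element `ζ`. -/
def stuff {A : Type*} (r : ℕ) (ζ : A) {D : ℕ} (ξ : Fin D → A) : Fin (D + r) → A :=
  fun i => if h : i.val < D then ξ ⟨i.val, h⟩ else ζ

/-- The trimming operator: remove the final `r` samples. -/
def trim {A : Type*} (r : ℕ) {D : ℕ} (ξ : Fin D → A) : Fin (D - r) → A :=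
  fun i => ξ ⟨i.val, by have := i.isLt; omega⟩

/-- Number of dummy samples that have to be padded to a signal with `D` samples. -/
def rpad (kst Bv D : ℕ) : ℕ :=
  if kst ∣ (D - Bv + 1) then 0 else kst - (D - Bv + 1) % kst

/-- The number of fragments after `j` layers of the sliding application equals the
stride product `k_j*`. -/
lemma evalSlide_cols (D : ℕ) (ξ : Fin D → M 0) :
    ∀ j : ℕ, (evalSlide M Nt c k T g D j ξ).2.1 = kstar k j := by
  intro j
  induction j with
  | zero => simp [evalSlide, kstar]
  | succ m ih => simp [evalSlide, kstar, Finset.prod_range_succ, ih, Nat.mul_comm]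

/-- `T(ξ) = Trimming_{r(ξ)}(Defrag_{k_L*}(EvalSlide_L(Stuffing_{r(ξ)}(ξ))))`. -/
def stuffSlideTrim (B L : ℕ) (ζ : M 0) {D : ℕ} (ξ : Fin D → M 0) :
    Σ q : ℕ, Fin q → M L :=
  ⟨kstar k L * (evalSlide M Nt c k T g (D + rpad (kstar k L) B D) L
      (stuff (rpad (kstar k L) B D) ζ ξ)).1 - rpad (kstar k L) B D,
    trim (rpad (kstar k L) B D)
      (fun i =>
        defrag (kstar k L)
          (fun i' (j : Fin (kstar k L * 1)) =>
            (evalSlide M Nt c k T g (D + rpad (kstar k L) B D) L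
              (stuff (rpad (kstar k L) B D) ζ ξ)).2.2 i'
              (Fin.cast (by
                rw [evalSlide_cols M Nt c k T g
                  (D + rpad (kstar k L) B D)
                  (stuff (rpad (kstar k L) B D) ζ ξ) L, Nat.mul_one]) j))
          i ⟨0, Nat.one_pos⟩)⟩

lemma kstar_succ (j : ℕ) : kstar k (j + 1) = kstar k j * k j :=
  Finset.prod_range_succ k j

lemma kstar_pos {j : ℕ} (hk : ∀ i, i < j → 0 < k i) : 0 < kstar k j :=
  Finset.prod_pos fun i hi => hk i (Finset.mem_range.mp hi)

lemma kstar_dvd_kstar {i j : ℕ} (h : i ≤ j) : kstar k i ∣ kstar k j :=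
  Finset.prod_dvd_prod_of_subset _ _ _ (Finset.range_subset_range.mpr h)

/-- Entries of a fragmented signal in terms of the entries of the original one. -/
lemma fragD_apply {A : Type*} {κ r s : ℕ} (ξ : Fin r → Fin s → A) (i : Fin (r / κ))
    (j : Fin (κ * s)) (a : Fin r) (b : Fin s) (ha : a.val = i.val * κ + j.val / s)
    (hb : b.val = j.val % s) : fragD κ ξ i j = ξ a b := by
  have hs : 0 < s := b.pos
  simp only [fragD, frag, mtrans, vecInv, vec]
  congr 1
  · ext
    rw [ha]
    simp only [Fin.val_castLE, Fin.val_cast]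
    rw [← mul_assoc, add_comm, Nat.add_mul_div_right _ _ hs, add_comm]
  · ext
    rw [hb]
    simp only [Fin.val_cast]
    rw [← mul_assoc, add_comm, Nat.add_mul_mod_self_right]

/-- Entries of a defragmented one-column signal. -/
lemma defrag_apply {A : Type*} {κ q : ℕ} (ξ : Fin q → Fin (κ * 1) → A) (i : Fin (κ * q))
    (a : Fin q) (b : Fin (κ * 1)) (ha : a.val = i.val / κ) (hb : b.val = i.val % κ) :
    defrag κ ξ i ⟨0, Nat.one_pos⟩ = ξ a b := by
  simp only [defrag, mtrans, vecInv, vec]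
  congr 1
  · ext; simp [ha]
  · ext; simp [hb]

/-- A subsignal that avoids the stuffed samples is a subsignal of the original signal. -/
lemma subsig_stuff {A : Type*} (r : ℕ) (ζ : A) {D : ℕ} (ξ : Fin D → A) (d i : ℕ)
    (h : i + d ≤ D) :
    subsig d i (stuff r ζ ξ) (h.trans (Nat.le_add_right D r)) = subsig d i ξ h := by
  funext ν
  have := ν.isLt
  simp only [subsig, stuff]
  rw [dif_pos (by omega)]

/-- After padding, the number of subsignals is divisible by the stride product. -/
lemma dvd_add_rpad {κ B D : ℕ} (hκ : 0 < κ) : κ ∣ D - B + 1 + rpad κ B D := by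
  unfold rpad
  split_ifs with h
  · simpa using h
  · have h1 := Nat.mod_lt (D - B + 1) hκ
    have h2 := Nat.div_add_mod (D - B + 1) κ
    refine ⟨(D - B + 1) / κ + 1, ?_⟩
    rw [mul_add, mul_one]
    omega

/-- The dimensionality of `evalStride` does not depend on the input samples. -/
lemma evalStride_fst_eq (B : ℕ) (ρ ρ' : Fin B → M 0) (j : ℕ) :
    (evalStride M Nt c k T g B j ρ).1 = (evalStride M Nt c k T g B j ρ').1 := by
  induction j with
  | zero => rfl
  | succ j ih => simp only [evalStride, ih]

variable {M Nt c k T g} in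
lemma StridedWellDefined.mul_fst {B L : ℕ} (hwd : StridedWellDefined M Nt c k T g B L)
    {j : ℕ} (hj : j < L) (ρ : Fin B → M 0) :
    k j * (evalStride M Nt c k T g B (j + 1) ρ).1 =
      (evalStride M Nt c k T g B j ρ).1 + 1 - c j :=
  Nat.mul_div_cancel' (hwd j hj ρ).1

/-- The number of rows of the fragmented signal produced by `evalSlide`. -/
lemma evalSlide_rows {B L : ℕ} (hk : ∀ j, j < L → 0 < k j)
    (hwd : StridedWellDefined M Nt c k T g B L) (ρ : Fin B → M 0) (D : ℕ) (ξ : Fin D → M 0)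
    (j : ℕ) (hj : j ≤ L) (n : ℕ) (hn : D + 1 = B + kstar k j * n) :
    (evalSlide M Nt c k T g D j ξ).1 + 1 = (evalStride M Nt c k T g B j ρ).1 + n := by
  induction j generalizing n with
  | zero => simpa [evalSlide, evalStride, kstar] using hn
  | succ j ih =>
    have hkj := hk j hj
    have hr := ih (Nat.le_of_succ_le hj) (k j * n) (by rw [hn, kstar_succ, mul_assoc])
    have hq := hwd.mul_fst hj ρ
    have hpos := (hwd j hj ρ).2
    change ((evalSlide M Nt c k T g D j ξ).1 + 1 - c j + 1 - k j) / k j + 1 = _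
    generalize (evalStride M Nt c k T g B (j + 1) ρ).1 = q at *
    obtain ⟨q, rfl⟩ : ∃ m, q = m + 1 := ⟨q - 1, by omega⟩
    have h1 := Nat.mul_pos hkj hpos
    have h2 : (evalSlide M Nt c k T g D j ξ).1 + 1 - c j + 1 - k j = k j * (q + n) := by
      rw [mul_add] at hq ⊢
      omega
    rw [h2, Nat.mul_div_cancel_left _ hkj]
    omega

/-- The strided application to the subsignal starting at `p` is found in the fragment
with index `p % kstar k j` of the sliding application, starting at row `p / kstar k j`. -/
lemma evalStride_subsig_eq_evalSlide {B L : ℕ} (hk : ∀ j, j < L → 0 < k j)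
    (hT : ∀ j, j < L → IsSCT (c j) (T j)) (hwd : StridedWellDefined M Nt c k T g B L)
    (D : ℕ) (ξ : Fin D → M 0) (hdvd : kstar k L ∣ D + 1 - B) (p : ℕ) (hp : p + B ≤ D)
    (j : ℕ) (hj : j ≤ L)
    (ν : Fin (evalStride M Nt c k T g B j (subsig B p ξ hp)).1)
    (a : Fin (evalSlide M Nt c k T g D j ξ).1) (b : Fin (evalSlide M Nt c k T g D j ξ).2.1)
    (ha : a.val = p / kstar k j + ν.val) (hb : b.val = p % kstar k j) :
    (evalStride M Nt c k T g B j (subsig B p ξ hp)).2 ν =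
      (evalSlide M Nt c k T g D j ξ).2.2 a b := by
  induction j with
  | zero =>
    change ξ _ = ξ _
    congr 1
    ext
    simpa [kstar] using ha.symm
  | succ j ih =>
    have hkj := hk j hj
    have hK : 0 < kstar k j := kstar_pos k fun i hi => hk i (hi.trans hj)
    have hcols := evalSlide_cols M Nt c k T g D ξ j
    have hq := hwd.mul_fst hj (subsig B p ξ hp)
    have hpos := (hwd j hj (subsig B p ξ hp)).2
    obtain ⟨n, hn⟩ := (kstar_dvd_kstar k (Nat.le_of_succ_le hj)).trans hdvd
    have hrows := evalSlide_rows M Nt c k T g hk hwd (subsig B p ξ hp) D ξ j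
      (Nat.le_of_succ_le hj) n (by omega)
    have hpn : p / kstar k j < n := by
      rw [Nat.div_lt_iff_lt_mul hK, mul_comm]
      omega
    have hq_pos := Nat.mul_pos hkj hpos
    have hν : k j * ν.val + k j ≤
        k j * (evalStride M Nt c k T g B (j + 1) (subsig B p ξ hp)).1 :=
      Nat.mul_le_mul_left (k j) ν.isLt
    have hb' : p % kstar k j < (evalSlide M Nt c k T g D j ξ).2.1 := by
      rw [hcols]
      exact Nat.mod_lt _ hK
    have hsub : (evalStride M Nt c k T g B j (subsig B p ξ hp)).2 =
        subsig (evalStride M Nt c k T g B j (subsig B p ξ hp)).1 (p / kstar k j)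
          (fun i => (evalSlide M Nt c k T g D j ξ).2.2 i ⟨p % kstar k j, hb'⟩)
          (by omega) := by
      funext μ
      exact ih (Nat.le_of_succ_le hj) μ _ _ rfl rfl
    have hrow : p / kstar k j + k j * ν.val <
        (evalSlide M Nt c k T g D j ξ).1 + 1 - c j + 1 - k j := by
      omega
    refine Eq.trans ?_ (fragD_apply
      (fun i col => slide (g j)
        (fun i' => T j _ (fun i'' => (evalSlide M Nt c k T g D j ξ).2.2 i'' col) i') i)
      a b ⟨p / kstar k j + k j * ν.val, hrow⟩
      ⟨p % kstar k j, hb'⟩ ?_ ?_).symm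
    · change g j _ = g j _
      congr 1
      funext μ
      change T j _ _ ⟨k j * ν.val + μ.val, _⟩ = T j _ _ ⟨p / kstar k j + k j * ν.val + μ.val, _⟩
      rw [hsub, hT j hj _ _ (by omega)]
      congr 1
      ext
      exact (add_assoc _ _ _).symm
    · change _ = a.val * k j + b.val / (evalSlide M Nt c k T g D j ξ).2.1
      rw [ha, hb, hcols, kstar_succ, Nat.mod_mul_right_div_self, ← Nat.div_div_eq_div_mul]
      have := Nat.div_add_mod (p / kstar k j) (k j)
      linarith
    · change p % kstar k j = b.val % (evalSlide M Nt c k T g D j ξ).2.1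
      rw [hb, hcols, kstar_succ, Nat.mod_mul_right_mod]

/-- The dimensionality reduction property of `stuffSlideTrim`. -/
lemma stuffSlideTrim_fst {B L : ℕ} (hk : ∀ j, j < L → 0 < k j)
    (hwd : StridedWellDefined M Nt c k T g B L)
    (hu1 : ∀ ρ : Fin B → M 0, (evalStride M Nt c k T g B L ρ).1 = 1)
    (ζ : M 0) {D : ℕ} (hD : B ≤ D) (ξ : Fin D → M 0) :
    (stuffSlideTrim M Nt c k T g B L ζ ξ).1 = D + 1 - B := by
  obtain ⟨n, hn⟩ := dvd_add_rpad (B := B) (D := D) (kstar_pos k hk)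
  have hrows := evalSlide_rows M Nt c k T g hk hwd (fun _ => ζ) _
    (stuff (rpad (kstar k L) B D) ζ ξ) L le_rfl n (by omega)
  rw [hu1, add_comm, Nat.add_left_cancel_iff] at hrows
  simp only [stuffSlideTrim]
  rw [hrows, ← hn]
  omega

/-- The samples of `stuffSlideTrim` are those of the sliding `evalStride`. -/
lemma stuffSlideTrim_snd {B L : ℕ} (hk : ∀ j, j < L → 0 < k j)
    (hT : ∀ j, j < L → IsSCT (c j) (T j)) (hwd : StridedWellDefined M Nt c k T g B L)
    (ζ : M 0) {D : ℕ} (ξ : Fin D → M 0) (i : ℕ) (hi : i + B ≤ D)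
    (h2 : i < (stuffSlideTrim M Nt c k T g B L ζ ξ).1)
    (h3 : 0 < (evalStride M Nt c k T g B L (subsig B i ξ hi)).1) :
    (stuffSlideTrim M Nt c k T g B L ζ ξ).2 ⟨i, h2⟩ =
      (evalStride M Nt c k T g B L (subsig B i ξ hi)).2 ⟨0, h3⟩ := by
  have hK := kstar_pos k hk
  have hdvd := dvd_add_rpad (B := B) (D := D) hK
  rw [show D - B + 1 + rpad (kstar k L) B D = D + rpad (kstar k L) B D + 1 - B by omega] at hdvd
  have hrow : i / kstar k L < (evalSlide M Nt c k T g (D + rpad (kstar k L) B D) L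
      (stuff (rpad (kstar k L) B D) ζ ξ)).1 := by
    rw [Nat.div_lt_iff_lt_mul hK, mul_comm]
    exact h2.trans_le (Nat.sub_le _ _)
  have hcol : i % kstar k L < kstar k L * 1 := by
    rw [mul_one]
    exact Nat.mod_lt _ hK
  have key := evalStride_subsig_eq_evalSlide M Nt c k T g hk hT hwd _
    (stuff (rpad (kstar k L) B D) ζ ξ) hdvd i (hi.trans (Nat.le_add_right _ _)) L le_rfl
  rw [subsig_stuff _ ζ ξ B i hi] at key
  simp only [stuffSlideTrim, trim]
  rw [defrag_apply _ _ ⟨i / kstar k L, hrow⟩ ⟨i % kstar k L, hcol⟩ rfl rfl]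
  exact (key ⟨0, h3⟩ _ _ rfl rfl).symm

/-- assume the processing chain is strided-well-defined and outputs
exactly one sample on signals of length `B`.  Then the transformation
`T(ξ) = Trimming_{r(ξ)}(Defrag_{k_L*}(EvalSlide_L(Stuffing_{r(ξ)}(ξ))))` is
well-defined (its construction above is total), it satisfies the dimensionality
reduction property with constant `B`, it agrees with `EvalStride_L` on signals of
length `B`, and it equals `Slide_{EvalStride_L}` sample-wise — in particular it is
a subsignal compatible transformation with dimensionality reduction constant `B`. -/
theorem stuffSlideTrim_eq_slide_evalStride (B L : ℕ) (hB : 0 < B) (hL : 0 < L)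
    (hc : ∀ j, j < L → 0 < c j) (hk : ∀ j, j < L → 0 < k j)
    (hT : ∀ j, j < L → IsSCT (c j) (T j))
    (hwd : StridedWellDefined M Nt c k T g B L)
    (hu1 : ∀ ρ : Fin B → M 0, (evalStride M Nt c k T g B L ρ).1 = 1)
    (ζ : M 0) :
    (∀ (D : ℕ), B ≤ D → ∀ ξ : Fin D → M 0,
      (stuffSlideTrim M Nt c k T g B L ζ ξ).1 = D + 1 - B) ∧
    (∀ (ρ : Fin B → M 0) (h0 : 0 < (stuffSlideTrim M Nt c k T g B L ζ ρ).1)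
        (h1 : 0 < (evalStride M Nt c k T g B L ρ).1),
      (stuffSlideTrim M Nt c k T g B L ζ ρ).2 ⟨0, h0⟩ =
        (evalStride M Nt c k T g B L ρ).2 ⟨0, h1⟩) ∧
    (∀ (D : ℕ) (hD : B ≤ D) (ξ : Fin D → M 0) (i : ℕ) (hiB : i + B ≤ D)
        (h2 : i < (stuffSlideTrim M Nt c k T g B L ζ ξ).1)
        (h3 : 0 < (evalStride M Nt c k T g B L (subsig B i ξ hiB)).1),
      (stuffSlideTrim M Nt c k T g B L ζ ξ).2 ⟨i, h2⟩ =
        (evalStride M Nt c k T g B L (subsig B i ξ hiB)).2 ⟨0, h3⟩) := by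
  refine ⟨fun D hD ξ => stuffSlideTrim_fst M Nt c k T g hk hwd hu1 ζ hD ξ,
    fun ρ h0 h1 => ?_,
    fun D _ ξ i hi h2 h3 => stuffSlideTrim_snd M Nt c k T g hk hT hwd ζ ξ i hi h2 h3⟩
  have hρ : subsig B 0 ρ (Nat.zero_add B).le = ρ := by
    funext ν
    simp [subsig]
  have key := stuffSlideTrim_snd M Nt c k T g hk hT hwd ζ ρ 0 (Nat.zero_add B).le h0
  rw [hρ] at key
  exact key h1

end Chain

end Scan
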